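/- arXiv:2103.04483 — 2 statements merged into one kernel-verified Lean document; each statement's English description precedes it below -/
import Mathlib

section
/- Let a ≥ 2 be an integer, let p be a prime, and let q be a prime dividing the generalized repunit R_p(a) = (a^p − 1)/(a − 1). Then either q ≡ 1 (mod p), or q = p and q divides a − 1. -/
/-- Let `a ≥ 2`, let `p` be a prime and let `q` be a prime dividing the generalized
repunit `R_p(a) = (a^p - 1)/(a - 1) = 1 + a + ⋯ + a^(p-1)`.  Then either
`q ≡ 1 (mod p)`, or `q = p` and `q` divides `a - 1`. -/
theorem repunit_prime_divisor (a p q : ℕ) (ha : 2 ≤ a) (hp : p.Prime) (hq : q.Prime)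
    (hdvd : q ∣ ∑ i ∈ Finset.range p, a ^ i) :
    q ≡ 1 [MOD p] ∨ (q = p ∧ q ∣ a - 1) := by
  haveI : Fact q.Prime := ⟨hq⟩
  haveI : Fact p.Prime := ⟨hp⟩
  have h0 : ∑ i ∈ Finset.range p, (a : ZMod q) ^ i = 0 := by
    have h := (ZMod.natCast_eq_zero_iff _ q).2 hdvd
    push_cast at h
    exact h
  have h1 : (a : ZMod q) ^ p = 1 := by
    have h := geom_sum_mul (a : ZMod q) p
    rw [h0, zero_mul] at h
    exact (sub_eq_zero.1 h.symm)
  by_cases hone : (a : ZMod q) = 1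
  · right
    rw [hone] at h0
    simp only [one_pow, Finset.sum_const, Finset.card_range, nsmul_eq_mul, mul_one] at h0
    refine ⟨(Nat.prime_dvd_prime_iff_eq hq hp).1 ((ZMod.natCast_eq_zero_iff _ q).1 h0), ?_⟩
    rw [← ZMod.natCast_eq_zero_iff, Nat.cast_sub (by omega), hone]
    simp
  · left
    have ho : orderOf (a : ZMod q) = p := orderOf_eq_prime h1 hone
    have hne : (a : ZMod q) ≠ 0 := by
      intro h
      rw [h, zero_pow hp.ne_zero] at h1
      exact zero_ne_one h1
    have hd : p ∣ q - 1 := by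
      rw [← ho]
      exact orderOf_dvd_of_pow_eq_one (ZMod.pow_card_sub_one_eq_one hne)
    exact ((Nat.modEq_iff_dvd' hq.one_le).2 hd).symm
end

section
/- Let k ≥ 1 be an integer. Then the infinite product ∏_{p > k} ((1 − k/p)/(1 − 1/p)^k) over primes p > k converges to a positive real number, and its logarithm equals −Σ_{j=2}^∞ ((k^j − k)/j)·(P(j) − Σ_{p ≤ k} p^{−j}), where the outer series converges; here the inner sum Σ_{p ≤ k} p^{−j} is over primes p ≤ k. -/
lemma hl_term_hasSum (k p : ℕ) (hk : 1 ≤ k) (hp : k < p) :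
    HasSum (fun j : ℕ => -((((k : ℝ) ^ (j + 2) - (k : ℝ)) / ((j : ℝ) + 2)) *
      ((p : ℝ) ^ (j + 2))⁻¹))
      (Real.log ((1 - (k : ℝ) / p) / (1 - 1 / (p : ℝ)) ^ k)) := by
  have hk' : (1 : ℝ) ≤ k := by exact_mod_cast hk
  have hp' : (k : ℝ) < p := by exact_mod_cast hp
  have hp0 : (0 : ℝ) < p := by linarith
  have h1 : |(k : ℝ) / p| < 1 := by
    rw [abs_of_nonneg (by positivity), div_lt_one hp0]; exact hp'
  have h2 : |1 / (p : ℝ)| < 1 := by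
    rw [abs_of_nonneg (by positivity), div_lt_one hp0]; linarith
  have e1 : 0 < 1 - (k : ℝ) / p := by linarith [(abs_lt.mp h1).2]
  have e2 : 0 < 1 - 1 / (p : ℝ) := by linarith [(abs_lt.mp h2).2]
  have H := ((Real.hasSum_pow_div_log_of_abs_lt_one h1).sub
    ((Real.hasSum_pow_div_log_of_abs_lt_one h2).mul_left (k : ℝ))).neg
  rw [← hasSum_nat_add_iff' 1] at H
  rw [Real.log_div e1.ne' (pow_pos e2 k).ne', Real.log_pow]
  convert H using 1
  · rfl
  · funext j
    push_cast
    have : (j : ℝ) + 1 + 1 = (j : ℝ) + 2 := by ring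
    rw [this, div_pow, div_pow, one_pow]
    have : (j : ℝ) + 2 ≠ 0 := by positivity
    field_simp
  · simp
    field_simp
    ring

lemma hl_prime_split (k s : ℕ) (hs : 2 ≤ s) :
    HasSum (fun p : {p : ℕ // p.Prime ∧ k < p} => (((p : ℕ) : ℝ) ^ s)⁻¹)
      ((∑' q : Nat.Primes, ((((q : ℕ) : ℝ)) ^ s)⁻¹) -
          ∑ q ∈ (Finset.range (k + 1)).filter Nat.Prime, (((q : ℝ)) ^ s)⁻¹) := by
  have hS : Summable (fun n : ℕ => ((n : ℝ) ^ s)⁻¹) := Real.summable_nat_pow_inv.mpr (by omega)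
  have hP : HasSum (fun q : {p : ℕ // p.Prime} => (((q : ℕ) : ℝ) ^ s)⁻¹)
      (∑' q : Nat.Primes, ((((q : ℕ) : ℝ)) ^ s)⁻¹) := (hS.subtype {p | p.Prime}).hasSum
  have hP' := (hasSum_subtype_iff_indicator (f := fun n : ℕ => ((n : ℝ) ^ s)⁻¹)
    (s := {p | p.Prime})).mp hP
  have hF : HasSum (fun n : ℕ => if n ∈ (Finset.range (k + 1)).filter Nat.Prime
      then ((n : ℝ) ^ s)⁻¹ else 0)
      (∑ q ∈ (Finset.range (k + 1)).filter Nat.Prime, (((q : ℝ)) ^ s)⁻¹) := by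
    have := hasSum_sum_of_ne_finset_zero (f := fun n : ℕ =>
      if n ∈ (Finset.range (k + 1)).filter Nat.Prime then ((n : ℝ) ^ s)⁻¹ else 0)
      (s := (Finset.range (k + 1)).filter Nat.Prime) (L := .unconditional ℕ) (by intro b hb; exact if_neg hb)
    convert this using 1
    exact Finset.sum_congr rfl (fun x hx => (if_pos hx).symm)
  have hsub := hP'.sub hF
  refine (hasSum_subtype_iff_indicator (f := fun n : ℕ => ((n : ℝ) ^ s)⁻¹)
    (s := {p | p.Prime ∧ k < p})).mpr ?_
  convert hsub using 1
  · rfl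
  funext n
  by_cases h1 : n.Prime <;> by_cases h2 : k < n
  · have : ¬ n < k + 1 := by omega
    simp [Set.indicator, h1, h2, this]
  · have : n < k + 1 := by omega
    simp [Set.indicator, h1, h2, this]
  · simp [Set.indicator, h1]
  · simp [Set.indicator, h1]

lemma hl_summable (k : ℕ) (hk : 1 ≤ k) :
    Summable (fun x : {p : ℕ // p.Prime ∧ k < p} × ℕ =>
      -((((k : ℝ) ^ (x.2 + 2) - (k : ℝ)) / ((x.2 : ℝ) + 2)) *
      (((x.1 : ℕ) : ℝ) ^ (x.2 + 2))⁻¹)) := by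
  have hk' : (1 : ℝ) ≤ k := by exact_mod_cast hk
  have hA : Summable (fun p : {p : ℕ // p.Prime ∧ k < p} =>
      (k : ℝ) ^ 2 * (((p : ℕ) : ℝ) ^ 2)⁻¹) :=
    (hl_prime_split k 2 le_rfl).summable.mul_left _
  have hB : Summable (fun j : ℕ => ((k : ℝ) / (k + 1)) ^ j) :=
    summable_geometric_of_lt_one (by positivity) (by rw [div_lt_one (by positivity)]; linarith)
  have hAB := hA.mul_of_nonneg hB (fun p => by positivity) (fun j => by positivity)
  refine Summable.neg (Summable.of_nonneg_of_le ?_ ?_ hAB)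
  · rintro ⟨p, j⟩
    have : (k : ℝ) ≤ (k : ℝ) ^ (j + 2) := le_self_pow₀ hk' (by omega)
    have : 0 ≤ (k : ℝ) ^ (j + 2) - k := by linarith
    dsimp only
    positivity
  · rintro ⟨⟨p, hp, hkp⟩, j⟩
    dsimp only
    have hp1 : (k : ℝ) + 1 ≤ p := by exact_mod_cast hkp
    have hp0 : (0 : ℝ) < p := by linarith
    have h1 : ((k : ℝ) ^ (j + 2) - k) / ((j : ℝ) + 2) ≤ (k : ℝ) ^ (j + 2) := by
      rw [div_le_iff₀ (by positivity)]
      have : 0 < (k : ℝ) ^ (j + 2) := by positivity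
      have hj : (0 : ℝ) ≤ j := by positivity
      nlinarith
    calc _ ≤ (k : ℝ) ^ (j + 2) * ((p : ℝ) ^ (j + 2))⁻¹ := by gcongr
      _ = (k : ℝ) ^ 2 * ((p : ℝ) ^ 2)⁻¹ * ((k : ℝ) / p) ^ j := by
        rw [div_pow]; field_simp; ring
      _ ≤ _ := by gcongr

/-- Let `k ≥ 1`.  The infinite product `∏_{p > k} (1 - k/p)/(1 - 1/p)^k` over primes
`p > k` converges to a positive real number, and its logarithm equals
`-Σ_{j=2}^∞ ((k^j - k)/j)·(P(j) - Σ_{p ≤ k} p^(-j))`, where `P` is the prime zeta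
function and the outer series converges. -/
theorem hardy_littlewood_constant_log (k : ℕ) (hk : 1 ≤ k) :
    Multipliable (fun p : {p : ℕ // p.Prime ∧ k < p} =>
        (1 - (k : ℝ) / (p : ℕ)) / (1 - 1 / ((p : ℕ) : ℝ)) ^ k) ∧
    0 < (∏' p : {p : ℕ // p.Prime ∧ k < p},
        (1 - (k : ℝ) / (p : ℕ)) / (1 - 1 / ((p : ℕ) : ℝ)) ^ k) ∧
    HasSum
      (fun j : ℕ => -((((k : ℝ) ^ (j + 2) - (k : ℝ)) / ((j : ℝ) + 2)) *
        ((∑' q : Nat.Primes, ((((q : ℕ) : ℝ)) ^ (j + 2))⁻¹) -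
          ∑ q ∈ (Finset.range (k + 1)).filter Nat.Prime, (((q : ℝ)) ^ (j + 2))⁻¹)))
      (Real.log (∏' p : {p : ℕ // p.Prime ∧ k < p},
        (1 - (k : ℝ) / (p : ℕ)) / (1 - 1 / ((p : ℕ) : ℝ)) ^ k)) := by
  have hpos : ∀ p : {p : ℕ // p.Prime ∧ k < p},
      0 < (1 - (k : ℝ) / (p : ℕ)) / (1 - 1 / ((p : ℕ) : ℝ)) ^ k := by
    rintro ⟨p, hp, hkp⟩
    have hk' : (1 : ℝ) ≤ k := by exact_mod_cast hk
    have hp' : (k : ℝ) < p := by exact_mod_cast hkp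
    have hp0 : (0 : ℝ) < p := by linarith
    have e1 : 0 < 1 - (k : ℝ) / p := by rw [sub_pos, div_lt_one hp0]; exact hp'
    have e2 : 0 < 1 - 1 / (p : ℝ) := by rw [sub_pos, div_lt_one hp0]; linarith
    exact div_pos e1 (pow_pos e2 k)
  have hsum := hl_summable k hk
  have hlog := hsum.hasSum.prod_fiberwise
    (fun p => hl_term_hasSum k (p : ℕ) hk p.2.2)
  have hexp := Real.rexp_tsum_eq_tprod hpos hlog.summable
  refine ⟨Real.multipliable_of_summable_log hpos hlog.summable, ?_, ?_⟩
  · rw [← hexp]; exact Real.exp_pos _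
  · rw [← hexp, Real.log_exp, hlog.tsum_eq]
    have hsw := (Equiv.prodComm ℕ {p : ℕ // p.Prime ∧ k < p}).hasSum_iff.mpr hsum.hasSum
    exact hsw.prod_fiberwise
      (fun j => ((hl_prime_split k (j + 2) (by omega)).mul_left _).neg)
end
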